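/- For all real t, ∫₀^∞ (e^{itx} − 1)·e^{−x}·(I₀(x) − I₁(x)) dx = it/√(−t(t + 2i)), where the square root is the principal branch. -/

import Mathlib

open Real MeasureTheory Complex

/-- Modified Bessel function of the first kind of nonnegative integer order. -/
noncomputable def besselI (ν : ℕ) (x : ℝ) : ℝ :=
  ∑' k : ℕ, (x / 2) ^ (2 * k + ν) / ((Nat.factorial k : ℝ) * (Nat.factorial (k + ν) : ℝ))

lemma cosInt_succ (n : ℕ) : ∫ θ in (0:ℝ)..2*π, Real.cos θ ^ (n+2) =
    (n+1)/(n+2) * ∫ θ in (0:ℝ)..2*π, Real.cos θ ^ n := by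
  rw [integral_cos_pow]; simp

lemma cosInt_odd (k : ℕ) : ∫ θ in (0:ℝ)..2*π, Real.cos θ ^ (2*k+1) = 0 := by
  induction k with
  | zero => simp
  | succ k ih => rw [show 2*(k+1)+1 = (2*k+1)+2 by ring, cosInt_succ, ih, mul_zero]

lemma cosInt_even (k : ℕ) : ∫ θ in (0:ℝ)..2*π, Real.cos θ ^ (2*k) =
    2*π * ((2*k).factorial / (4^k * (k.factorial:ℝ)^2)) := by
  induction k with
  | zero => simp
  | succ k ih =>
    rw [show 2*(k+1) = (2*k)+2 by ring, cosInt_succ, ih]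
    simp only [Nat.factorial_succ, pow_succ]
    push_cast
    have : (k.factorial:ℝ) ≠ 0 := by positivity
    field_simp
    ring

lemma cosSeries (ν : ℕ) (x : ℝ) :
    HasSum (fun n : ℕ => x^n / n.factorial * ∫ θ in (0:ℝ)..2*π, Real.cos θ ^ (n+ν))
      (∫ θ in (0:ℝ)..2*π, Real.exp (x * Real.cos θ) * Real.cos θ ^ ν) := by
  have h := intervalIntegral.hasSum_integral_of_dominated_convergence
    (μ := volume) (a := 0) (b := 2*π)
    (F := fun (n:ℕ) (θ:ℝ) => x^n / n.factorial * Real.cos θ ^ (n+ν))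
    (f := fun θ => Real.exp (x * Real.cos θ) * Real.cos θ ^ ν)
    (fun n _ => |x|^n / n.factorial) ?_ ?_ ?_ ?_ ?_
  · simpa only [intervalIntegral.integral_const_mul] using h
  · intro n
    apply Continuous.aestronglyMeasurable
    fun_prop
  · intro n
    filter_upwards with θ _
    rw [norm_mul, norm_div, norm_pow, norm_pow]
    have h1 : |Real.cos θ| ^ (n+ν) ≤ 1 := pow_le_one₀ (abs_nonneg _) (Real.abs_cos_le_one θ)
    have h2 : ‖(n.factorial : ℝ)‖ = n.factorial := by simp
    rw [h2, Real.norm_eq_abs, Real.norm_eq_abs]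
    exact mul_le_of_le_one_right (by positivity) h1
  · filter_upwards with θ _
    exact Real.summable_pow_div_factorial |x|
  · simp
  · filter_upwards with θ _
    have h := (NormedSpace.expSeries_div_hasSum_exp (x * Real.cos θ)).mul_right (Real.cos θ ^ ν)
    rw [← Real.exp_eq_exp_ℝ] at h
    have e : (fun n : ℕ => x^n / n.factorial * Real.cos θ ^ (n+ν)) =
        fun n : ℕ => (x * Real.cos θ) ^ n / n.factorial * Real.cos θ ^ ν := by
      ext n
      rw [mul_pow, pow_add]; ring
    rw [e]; exact h

lemma bessel0 (x : ℝ) : ∫ θ in (0:ℝ)..2*π, Real.exp (x * Real.cos θ) = 2*π * besselI 0 x := by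
  have h := cosSeries 0 x
  have hi : Function.Injective (fun k : ℕ => 2*k) := fun a b h => by simpa using h
  rw [← hi.hasSum_iff] at h
  · simp only [pow_zero, mul_one] at h
    rw [← h.tsum_eq, besselI, ← tsum_mul_left]
    congr 1; ext k
    simp only [Function.comp, add_zero, cosInt_even, div_pow]
    have h4 : (2:ℝ)^(2*k) = 4^k := by rw [pow_mul]; norm_num
    rw [h4]
    have : (k.factorial:ℝ) ≠ 0 := by positivity
    have : ((2*k).factorial:ℝ) ≠ 0 := by positivity
    field_simp
  · intro n hn
    rcases Nat.even_or_odd' n with ⟨k, rfl | rfl⟩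
    · exact absurd ⟨k, rfl⟩ hn
    · simp only [add_zero, cosInt_odd, mul_zero]

lemma bessel1 (x : ℝ) : ∫ θ in (0:ℝ)..2*π, Real.exp (x * Real.cos θ) * Real.cos θ
    = 2*π * besselI 1 x := by
  have h := cosSeries 1 x
  have hi : Function.Injective (fun k : ℕ => 2*k+1) := fun a b h => by simpa using h
  rw [← hi.hasSum_iff] at h
  · simp only [pow_one] at h
    rw [← h.tsum_eq, besselI, ← tsum_mul_left]
    congr 1; ext k
    simp only [Function.comp]
    rw [show 2*k+1+1 = 2*(k+1) by ring, cosInt_even, div_pow]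
    have h4 : (2:ℝ)^(2*k+1) = 2 * 4^k := by rw [pow_succ, pow_mul]; norm_num; ring
    rw [h4, show 2*(k+1) = (2*k+1)+1 by ring, Nat.factorial_succ (2*k+1), Nat.factorial_succ k]
    have : (k.factorial:ℝ) ≠ 0 := by positivity
    have : ((2*k+1).factorial:ℝ) ≠ 0 := by positivity
    push_cast
    field_simp
    ring
  · intro n hn
    rcases Nat.even_or_odd' n with ⟨k, rfl | rfl⟩
    · simp only [cosInt_odd, mul_zero]
    · exact absurd ⟨k, rfl⟩ hn

lemma besselDiff (x : ℝ) : Real.exp (-x) * (besselI 0 x - besselI 1 x) =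
    (2*π)⁻¹ * ∫ θ in Set.Ioo (0:ℝ) (2*π),
      (1 - Real.cos θ) * Real.exp (-(1 - Real.cos θ) * x) := by
  have hp : (0:ℝ) ≤ 2*π := by positivity
  rw [← integral_Ioc_eq_integral_Ioo, ← intervalIntegral.integral_of_le hp]
  have h : ∀ θ : ℝ, (1 - Real.cos θ) * Real.exp (-(1 - Real.cos θ) * x) =
      Real.exp (-x) * (Real.exp (x * Real.cos θ) - Real.exp (x * Real.cos θ) * Real.cos θ) := by
    intro θ
    rw [show -(1 - Real.cos θ) * x = -x + x * Real.cos θ by ring, Real.exp_add]; ring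
  simp only [h]
  rw [intervalIntegral.integral_const_mul, intervalIntegral.integral_sub, bessel0, bessel1]
  · field_simp
  · apply Continuous.intervalIntegrable; fun_prop
  · apply Continuous.intervalIntegrable; fun_prop

lemma inner_int (t a : ℝ) (ha : 0 < a) :
    ∫ x in Set.Ioi (0:ℝ), (Complex.exp (Complex.I * t * x) - 1) * ((a * Real.exp (-a * x) : ℝ) : ℂ)
      = Complex.I * t * (a - Complex.I * t)⁻¹ := by
  have h1 : (Complex.I * t - a).re < 0 := by simpa
  have h2 : (-(a:ℂ)).re < 0 := by simpa
  have h : ∀ x : ℝ, (Complex.exp (Complex.I * t * x) - 1) * ((a * Real.exp (-a * x) : ℝ) : ℂ) =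
      a * (Complex.exp ((Complex.I * t - a) * x) - Complex.exp (-(a:ℂ) * x)) := by
    intro x
    push_cast
    rw [show (Complex.I * t - a) * x = Complex.I * t * x + -(a:ℂ) * x by ring, Complex.exp_add]
    ring
  simp only [h]
  rw [integral_const_mul, integral_sub (integrableOn_exp_mul_complex_Ioi h1 0)
    (integrableOn_exp_mul_complex_Ioi h2 0), integral_exp_mul_complex_Ioi h1,
    integral_exp_mul_complex_Ioi h2]
  have n1 : (Complex.I * t - a) ≠ 0 := by intro h; simp [h] at h1
  have n2 : (a:ℂ) ≠ 0 := by exact_mod_cast ha.ne'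
  have n3 : (a - Complex.I * t) ≠ 0 := by rw [← neg_sub]; exact neg_ne_zero.2 n1
  simp only [Complex.ofReal_zero, mul_zero, Complex.exp_zero]
  field_simp
  ring

lemma a_pos {θ : ℝ} (h : θ ∈ Set.Ioo (0:ℝ) (2*π)) : 0 < 1 - Real.cos θ := by
  have h1 := Real.cos_le_one θ
  rcases h1.lt_or_eq with h1 | h1
  · linarith
  · have := (Real.cos_eq_one_iff_of_lt_of_lt (by linarith [h.1, h.2]) h.2).1 h1
    linarith [h.1]

lemma base_integrable : Integrable (fun p : ℝ × ℝ =>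
      (1 - Real.cos p.2) * Real.exp (-(1 - Real.cos p.2) * p.1))
    ((volume.restrict (Set.Ioi (0:ℝ))).prod (volume.restrict (Set.Ioo (0:ℝ) (2*π)))) := by
  have hm : AEStronglyMeasurable (fun p : ℝ × ℝ =>
      (1 - Real.cos p.2) * Real.exp (-(1 - Real.cos p.2) * p.1))
    ((volume.restrict (Set.Ioi (0:ℝ))).prod (volume.restrict (Set.Ioo (0:ℝ) (2*π)))) := by
    apply Continuous.aestronglyMeasurable; fun_prop
  rw [integrable_prod_iff' hm]
  constructor
  · filter_upwards [ae_restrict_mem measurableSet_Ioo] with θ hθ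
    exact (integrableOn_exp_mul_Ioi (neg_lt_zero.2 (a_pos hθ)) 0).const_mul _
  · have : Integrable (fun _ : ℝ => (1:ℝ)) (volume.restrict (Set.Ioo (0:ℝ) (2*π))) :=
      integrable_const _
    refine this.congr ?_
    filter_upwards [ae_restrict_mem measurableSet_Ioo] with θ hθ
    have ha := a_pos hθ
    have : ∀ x : ℝ, ‖(1 - Real.cos θ) * Real.exp (-(1 - Real.cos θ) * x)‖ =
      (1 - Real.cos θ) * Real.exp (-(1 - Real.cos θ) * x) := fun x =>
        Real.norm_of_nonneg (by positivity)
    simp only [this]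
    rw [integral_const_mul, integral_exp_mul_Ioi (neg_lt_zero.2 ha)]
    have ha' := ha.ne'
    simp only [mul_zero, Real.exp_zero]
    rw [neg_div_neg_eq, mul_one_div, div_self ha']

lemma full_integrable (t : ℝ) : Integrable (fun p : ℝ × ℝ =>
      (Complex.exp (Complex.I * t * p.1) - 1) *
       (((1 - Real.cos p.2) * Real.exp (-(1 - Real.cos p.2) * p.1) : ℝ) : ℂ))
    ((volume.restrict (Set.Ioi (0:ℝ))).prod (volume.restrict (Set.Ioo (0:ℝ) (2*π)))) := by
  refine base_integrable.ofReal.bdd_mul (c := 2) ?_ ?_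
  · apply Continuous.aestronglyMeasurable; fun_prop
  · filter_upwards with p
    refine (norm_sub_le _ _).trans ?_
    rw [show Complex.I * t * p.1 = ((t * p.1 : ℝ) : ℂ) * Complex.I by push_cast; ring,
      Complex.norm_exp_ofReal_mul_I]
    norm_num

lemma sqrt_facts (t : ℝ) (ht : t ≠ 0) (ρ : ℂ)
    (hρ : ρ = (-(t : ℂ) * ((t : ℂ) + 2 * Complex.I)) ^ ((1 : ℂ) / 2)) :
    ρ ^ 2 = (1 - Complex.I * t)^2 - 1 ∧ ρ ≠ 0 ∧
      ‖(1 - Complex.I * t) - ρ‖ < 1 := by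
  have h2 : ρ ^ 2 = -(t : ℂ) * ((t : ℂ) + 2 * Complex.I) := by
    rw [hρ, one_div]; exact Complex.cpow_nat_inv_pow _ two_ne_zero
  have h2' : ρ ^ 2 = (1 - Complex.I * t)^2 - 1 := by
    rw [h2]; linear_combination (-(t:ℂ)^2) * Complex.I_sq
  have hre : 0 ≤ ρ.re := by
    rw [hρ, one_div, Complex.cpow_inv_two_re]; positivity
  have hR := congrArg Complex.re h2
  have hI := congrArg Complex.im h2
  simp [pow_two] at hR hI
  have hp : 0 < ρ.re := by
    refine lt_of_le_of_ne hre ?_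
    intro h; rw [← h] at hI; apply ht; linarith
  refine ⟨h2', ?_, ?_⟩
  · intro h; simp [h] at hp
  · have hprod : ‖(1 - Complex.I * t) - ρ‖ * ‖(1 - Complex.I * t) + ρ‖ = 1 := by
      rw [← norm_mul, show ((1 - Complex.I * t) - ρ) * ((1 - Complex.I * t) + ρ) = 1 by
        linear_combination -h2']
      simp
    have hlt : ‖(1 - Complex.I * t) - ρ‖ < ‖(1 - Complex.I * t) + ρ‖ := by
      apply lt_of_pow_lt_pow_left₀ 2 (norm_nonneg _)
      rw [← Complex.normSq_eq_norm_sq, ← Complex.normSq_eq_norm_sq, Complex.normSq_apply,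
        Complex.normSq_apply]
      simp
      have : t = -(ρ.re * ρ.im) := by linarith
      rw [this]
      nlinarith [mul_nonneg hre (sq_nonneg ρ.im)]
    nlinarith [norm_nonneg ((1 - Complex.I * t) - ρ)]

lemma circ (s ρ : ℂ) (h : ρ^2 = s^2 - 1) (hρ : ρ ≠ 0) (hw : ‖s - ρ‖ < 1) :
    ∫ θ in (0:ℝ)..2*π, (s - (Real.cos θ : ℂ))⁻¹ = 2 * π / ρ := by
  have hprod : (s - ρ) * (s + ρ) = 1 := by linear_combination -h
  have hv : 1 < ‖s + ρ‖ := by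
    have := congrArg norm hprod
    rw [norm_mul, norm_one] at this
    by_contra! hc
    nlinarith [norm_nonneg (s-ρ), norm_nonneg (s+ρ)]
  have hd : DifferentiableOn ℂ (fun z : ℂ => (z - (s + ρ))⁻¹) (Metric.closedBall 0 1) := by
    intro z hz
    have : z - (s+ρ) ≠ 0 := by
      intro h0
      rw [sub_eq_zero.1 h0] at hz
      simp at hz; linarith
    exact (DifferentiableAt.inv (h := fun z : ℂ => z - (s + ρ)) (by fun_prop) this).differentiableWithinAt
  have hc := hd.circleIntegral_sub_inv_smul (w := s - ρ) (by simpa using hw)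
  rw [circleIntegral] at hc
  have key : ∀ θ : ℝ, (s - (Real.cos θ : ℂ))⁻¹ = (2 * Complex.I) *
      (deriv (circleMap 0 1) θ • ((circleMap 0 1 θ - (s - ρ))⁻¹ • (circleMap 0 1 θ - (s + ρ))⁻¹)) := by
    intro θ
    have hz : circleMap 0 1 θ = Complex.exp (θ * Complex.I) := by simp [circleMap]
    have hcos : (Real.cos θ : ℂ) = (Complex.exp (θ * Complex.I) + (Complex.exp (θ * Complex.I))⁻¹)/2 := by
      rw [Complex.ofReal_cos, Complex.cos, ← Complex.exp_neg, neg_mul]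
    rw [deriv_circleMap, hz, hcos]
    have hn : ‖Complex.exp (θ * Complex.I)‖ = 1 := Complex.norm_exp_ofReal_mul_I θ
    have hz0 : Complex.exp (θ * Complex.I) ≠ 0 := Complex.exp_ne_zero _
    generalize Complex.exp (θ * Complex.I) = z at *
    simp only [smul_eq_mul]
    have e1 : z - (s - ρ) ≠ 0 := by
      intro h0; rw [← sub_eq_zero.1 h0] at hw; linarith
    have e2 : z - (s + ρ) ≠ 0 := by
      intro h0; rw [← sub_eq_zero.1 h0] at hv; linarith
    have e3 : s - (z + z⁻¹)/2 = -((z - (s-ρ)) * (z - (s+ρ))) / (2*z) := by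
      field_simp
      linear_combination -h
    rw [e3, inv_div]
    field_simp
    rw [Complex.I_sq]
    try ring
  simp only [key]
  rw [intervalIntegral.integral_const_mul, hc]
  rw [show s - ρ - (s+ρ) = -(2*ρ) by ring]
  simp only [smul_eq_mul]
  field_simp
  rw [Complex.I_sq]
  try ring

theorem stmt_19 (t : ℝ) :
    ∫ x in Set.Ioi (0:ℝ),
      (Complex.exp (Complex.I * t * x) - 1) *
        (Real.exp (-x) * (besselI 0 x - besselI 1 x) : ℝ)
    = Complex.I * t / ((-(t : ℂ) * ((t : ℂ) + 2 * Complex.I)) ^ ((1 : ℂ) / 2)) := by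
  rcases eq_or_ne t 0 with rfl | ht
  · simp
  have h : ∀ x : ℝ, (Complex.exp (Complex.I * t * x) - 1) *
        ((Real.exp (-x) * (besselI 0 x - besselI 1 x) : ℝ) : ℂ) =
      (2*π : ℂ)⁻¹ * ∫ θ in Set.Ioo (0:ℝ) (2*π), (Complex.exp (Complex.I * t * x) - 1) *
        (((1 - Real.cos θ) * Real.exp (-(1 - Real.cos θ) * x) : ℝ) : ℂ) := by
    intro x
    rw [besselDiff, integral_const_mul, integral_complex_ofReal]
    push_cast
    ring
  simp only [h]
  rw [integral_const_mul, integral_integral_swap (full_integrable t)]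
  have h3 : ∫ θ in Set.Ioo (0:ℝ) (2*π), ∫ x in Set.Ioi (0:ℝ),
      (Complex.exp (Complex.I * t * x) - 1) *
        (((1 - Real.cos θ) * Real.exp (-(1 - Real.cos θ) * x) : ℝ) : ℂ) =
      ∫ θ in Set.Ioo (0:ℝ) (2*π),
        Complex.I * t * ((1 - Complex.I * t) - (Real.cos θ : ℂ))⁻¹ := by
    refine setIntegral_congr_fun measurableSet_Ioo fun θ hθ => ?_
    rw [inner_int t _ (a_pos hθ)]
    congr 2
    push_cast
    ring
  have hp : (0:ℝ) ≤ 2*π := by positivity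
  obtain ⟨f1, f2, f3⟩ := sqrt_facts t ht _ rfl
  rw [h3, integral_const_mul, ← integral_Ioc_eq_integral_Ioo, ← intervalIntegral.integral_of_le hp,
    circ _ _ f1 f2 f3]
  have : (π:ℂ) ≠ 0 := by exact_mod_cast Real.pi_ne_zero
  field_simp
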